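/- Let n ∈ ℕ, J ⊆ R_n an ideal, and ⪯ an Inc(ℕ)-compatible term order on R. Then for every p ∈ Inc(ℕ), p·in_⪯(J) = in_⪯(p·J), where p·J is regarded as an ideal of R_{p([n])}. -/

import Mathlib

open MvPolynomial

/-- The ambient polynomial ring `R = K[x_{i,j} | i ∈ [c], j ∈ ℕ]`
(second variable indices are written `0`-based). -/
abbrev PolyR (K : Type*) [Field K] (c : ℕ) : Type _ := MvPolynomial (Fin c × ℕ) K

/-- The action of `p : ℕ → ℕ` on variable indices: `x_{i,j} ↦ x_{i,p(j)}`. -/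
def incVar (c : ℕ) (p : ℕ → ℕ) : Fin c × ℕ → Fin c × ℕ := fun v => (v.1, p v.2)

/-- The `K`-linear (in fact `K`-algebra) action of `p : ℕ → ℕ` on `R`. -/
noncomputable def incAct (K : Type*) [Field K] (c : ℕ) (p : ℕ → ℕ) :
    PolyR K c →ₐ[K] PolyR K c := rename (incVar c p)

/-- `Inc(ℕ)_{m,n}`: strictly increasing maps sending the first `m` variable indices
into the first `n` variable indices. -/
def IncIn (m n : ℕ) : Set (ℕ → ℕ) := {p | StrictMono p ∧ ∀ j < m, p j < n}

/-- `R_A`: the polynomials using only variables `x_{i,j}` with `j ∈ A`. -/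
def RsetOn (K : Type*) [Field K] (c : ℕ) (A : Set ℕ) : Set (PolyR K c) :=
  (supported K {v : Fin c × ℕ | v.2 ∈ A} : Subalgebra K (PolyR K c))

/-- `R_n`: the polynomials using only the first `n` variable indices. -/
def Rset (K : Type*) [Field K] (c n : ℕ) : Set (PolyR K c) := RsetOn K c {j | j < n}

/-- `J` is an ideal of the subring of `R` with underlying set `A`. -/
def IsIdealOf {K : Type*} [Field K] {c : ℕ} (J A : Set (PolyR K c)) : Prop :=
  J ⊆ A ∧ (0 : PolyR K c) ∈ J ∧ (∀ f ∈ J, ∀ g ∈ J, f + g ∈ J) ∧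
    ∀ a ∈ A, ∀ f ∈ J, a * f ∈ J

/-- The ideal of the subring of `R` with underlying set `A` generated by `S`. -/
def spanIn {K : Type*} [Field K] {c : ℕ} (A S : Set (PolyR K c)) : Set (PolyR K c) :=
  ⋂₀ {J : Set (PolyR K c) | IsIdealOf J A ∧ S ⊆ J}

/-- The set `Inc(ℕ)_{m,n} · S`. -/
def incOrbit (K : Type*) [Field K] (c m n : ℕ) (S : Set (PolyR K c)) : Set (PolyR K c) :=
  {g | ∃ p ∈ IncIn m n, ∃ f ∈ S, g = incAct K c p f}

/-- An `Inc(ℕ)`-invariant ideal chain in `R`. -/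
def IsIncChain (K : Type*) [Field K] (c : ℕ) (J : ℕ → Set (PolyR K c)) : Prop :=
  (∀ n, IsIdealOf (J n) (Rset K c n)) ∧
    ∀ m n, m ≤ n → incOrbit K c m n (J m) ⊆ J n

/-- The set of indices from which on the chain `J` is generated by `Inc(ℕ)`-shifts. -/
def stabSet (K : Type*) [Field K] (c : ℕ) (J : ℕ → Set (PolyR K c)) : Set ℕ :=
  {N | ∀ n, N ≤ n → spanIn (Rset K c n) (incOrbit K c N n (J N)) = J n}

/-- The stability index `Ind(J∘)` of an ideal chain. -/
noncomputable def Ind (K : Type*) [Field K] (c : ℕ) (J : ℕ → Set (PolyR K c)) : ℕ :=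
  sInf (stabSet K c J)

/-- A term order: a total order on monomials (identified with their exponent vectors,
so that multiplication of monomials becomes addition) which respects multiplication and
has the monomial `1` (exponent vector `0`) as least element. -/
structure TermOrder (σ : Type*) where
  le : (σ →₀ ℕ) → (σ →₀ ℕ) → Prop
  refl : ∀ a, le a a
  trans : ∀ a b c, le a b → le b c → le a c
  antisymm : ∀ a b, le a b → le b a → a = b
  total : ∀ a b, le a b ∨ le b a
  add_right : ∀ a b h, le a b → le (a + h) (b + h)
  zero_le : ∀ a, le 0 a

/-- A term order on `R` is `Inc(ℕ)`-compatible if it is preserved by the action of every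
strictly increasing map. -/
def IncCompatible (c : ℕ) (T : TermOrder (Fin c × ℕ)) : Prop :=
  ∀ p : ℕ → ℕ, StrictMono p → ∀ a b, T.le a b →
    T.le (Finsupp.mapDomain (incVar c p) a) (Finsupp.mapDomain (incVar c p) b)

/-- `a` is the exponent vector of the leading monomial of `f` with respect to `T`. -/
def IsLeadMon {K : Type*} [Field K] {c : ℕ} (T : TermOrder (Fin c × ℕ))
    (f : PolyR K c) (a : (Fin c × ℕ) →₀ ℕ) : Prop :=
  a ∈ f.support ∧ ∀ b ∈ f.support, T.le b a

/-- The set of leading monomials of the nonzero elements of `J`. -/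
def leadMonSet (K : Type*) [Field K] (c : ℕ) (T : TermOrder (Fin c × ℕ))
    (J : Set (PolyR K c)) : Set (PolyR K c) :=
  {g | ∃ f ∈ J, f ≠ 0 ∧ ∃ a, IsLeadMon T f a ∧ g = monomial a (1 : K)}

/-- The initial ideal of `J`, as an ideal of `R_A`. -/
def initialOn (K : Type*) [Field K] (c : ℕ) (T : TermOrder (Fin c × ℕ)) (A : Set ℕ)
    (J : Set (PolyR K c)) : Set (PolyR K c) :=
  spanIn (RsetOn K c A) (leadMonSet K c T J)

/-- The chain of initial ideals `in_T(J_1) ⊆ in_T(J_2) ⊆ ...`. -/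
def inChain (K : Type*) [Field K] (c : ℕ) (T : TermOrder (Fin c × ℕ))
    (J : ℕ → Set (PolyR K c)) : ℕ → Set (PolyR K c) :=
  fun n => initialOn K c T {j | j < n} (J n)

/-- `I(J∘)`: the set of stability indices of initial ideal chains of `J` with respect to
`Inc(ℕ)`-compatible term orders. -/
def IndSet (K : Type*) [Field K] (c : ℕ) (J : ℕ → Set (PolyR K c)) : Set ℕ :=
  {N | ∃ T : TermOrder (Fin c × ℕ), IncCompatible c T ∧ Ind K c (inChain K c T J) = N}

/-- `S_n`: bijections of the variable indices fixing all indices outside the first `n`. -/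
def SymN (n : ℕ) : Set (ℕ → ℕ) := {σ | Function.Bijective σ ∧ ∀ i, n ≤ i → σ i = i}

/-- An `S_∞`-invariant ideal chain in `R`. -/
def IsSymChain (K : Type*) [Field K] (c : ℕ) (J : ℕ → Set (PolyR K c)) : Prop :=
  (∀ n, IsIdealOf (J n) (Rset K c n)) ∧
    ∀ m n, m ≤ n → ∀ σ ∈ SymN n, ∀ f ∈ J m, incAct K c σ f ∈ J n

theorem isIdealOf_RsetOn (K : Type*) [Field K] (c : ℕ) (A : Set ℕ) :
    IsIdealOf (RsetOn K c A) (RsetOn K c A) :=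
  ⟨subset_rfl, zero_mem (supported K _), fun _ hf _ hg => add_mem (S := Subalgebra K _) hf hg,
    fun _ ha _ hf => mul_mem (S := Subalgebra K _) ha hf⟩

theorem subset_spanIn {K : Type*} [Field K] {c : ℕ} (A S : Set (PolyR K c)) :
    S ⊆ spanIn A S :=
  Set.subset_sInter fun _ hI => hI.2

theorem spanIn_subset {K : Type*} [Field K] {c : ℕ} {A S I : Set (PolyR K c)}
    (hI : IsIdealOf I A) (hS : S ⊆ I) : spanIn A S ⊆ I :=
  Set.sInter_subset_of_mem ⟨hI, hS⟩

theorem isIdealOf_spanIn {K : Type*} [Field K] {c : ℕ} {A S : Set (PolyR K c)}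
    (hA : IsIdealOf A A) (hS : S ⊆ A) : IsIdealOf (spanIn A S) A :=
  ⟨spanIn_subset hA hS, fun _ hI => hI.1.2.1,
    fun f hf g hg I hI => hI.1.2.2.1 f (hf I hI) g (hg I hI),
    fun a ha f hf I hI => hI.1.2.2.2 a ha f (hf I hI)⟩

theorem IsIdealOf.image {K : Type*} [Field K] {c : ℕ} {I A : Set (PolyR K c)}
    (hI : IsIdealOf I A) (φ : PolyR K c →ₐ[K] PolyR K c) : IsIdealOf (φ '' I) (φ '' A) := by
  refine ⟨Set.image_mono hI.1, ⟨0, hI.2.1, map_zero φ⟩, ?_, ?_⟩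
  · rintro _ ⟨f, hf, rfl⟩ _ ⟨g, hg, rfl⟩
    exact ⟨f + g, hI.2.2.1 f hf g hg, map_add φ f g⟩
  · rintro _ ⟨a, ha, rfl⟩ _ ⟨f, hf, rfl⟩
    exact ⟨a * f, hI.2.2.2 a ha f hf, map_mul φ a f⟩

theorem IsIdealOf.inter_preimage {K : Type*} [Field K] {c : ℕ} {I A : Set (PolyR K c)}
    (hA : IsIdealOf A A) (φ : PolyR K c →ₐ[K] PolyR K c) (hI : IsIdealOf I (φ '' A)) :
    IsIdealOf (A ∩ φ ⁻¹' I) A := by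
  refine ⟨Set.inter_subset_left, ⟨hA.2.1, ?_⟩, fun f hf g hg => ⟨hA.2.2.1 f hf.1 g hg.1, ?_⟩,
    fun a ha f hf => ⟨hA.2.2.2 a ha f hf.1, ?_⟩⟩
  · simpa using hI.2.1
  · simpa using hI.2.2.1 _ hf.2 _ hg.2
  · simpa using hI.2.2.2 _ (Set.mem_image_of_mem φ ha) _ hf.2

theorem image_spanIn {K : Type*} [Field K] {c : ℕ} {A S : Set (PolyR K c)}
    (hA : IsIdealOf A A) (hS : S ⊆ A) (φ : PolyR K c →ₐ[K] PolyR K c) :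
    φ '' spanIn A S = spanIn (φ '' A) (φ '' S) := by
  apply Set.Subset.antisymm
  · rintro _ ⟨f, hf, rfl⟩ I ⟨hI, hSI⟩
    exact (spanIn_subset (hA.inter_preimage φ hI)
      (Set.subset_inter hS (Set.image_subset_iff.mp hSI)) hf).2
  · exact spanIn_subset ((isIdealOf_spanIn hA hS).image φ) (Set.image_mono (subset_spanIn A S))

theorem incVar_injective (c : ℕ) {p : ℕ → ℕ} (hp : Function.Injective p) :
    Function.Injective (incVar c p) := by
  rintro ⟨i, j⟩ ⟨i', j'⟩ h
  simp only [incVar, Prod.mk.injEq] at h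
  exact Prod.ext h.1 (hp h.2)

theorem incAct_image_RsetOn (K : Type*) [Field K] (c : ℕ) (p : ℕ → ℕ) (A : Set ℕ) :
    incAct K c p '' RsetOn K c A = RsetOn K c (p '' A) := by
  have hvar : incVar c p '' {v | v.2 ∈ A} = {v | v.2 ∈ p '' A} := by
    ext ⟨i, j⟩
    simp [incVar]
  rw [RsetOn, RsetOn, ← Subalgebra.coe_map, ← hvar, supported, supported, AlgHom.map_adjoin,
    Set.image_image, Set.image_image]
  simp only [incAct, rename_X]

theorem mem_RsetOn_of_mem_support {K : Type*} [Field K] {c : ℕ} {A : Set ℕ} {f : PolyR K c}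
    (hf : f ∈ RsetOn K c A) {a : (Fin c × ℕ) →₀ ℕ} (ha : a ∈ f.support) :
    monomial a (1 : K) ∈ RsetOn K c A := by
  classical
  refine mem_supported.mpr fun v hv => mem_supported.mp hf ?_
  rw [Finset.mem_coe, vars_monomial one_ne_zero] at hv
  exact mem_vars_iff_mem_support v |>.mpr ⟨a, ha, hv⟩

theorem leadMonSet_subset {K : Type*} [Field K] {c : ℕ} (T : TermOrder (Fin c × ℕ))
    {A : Set ℕ} {J : Set (PolyR K c)} (hJ : J ⊆ RsetOn K c A) :
    leadMonSet K c T J ⊆ RsetOn K c A := by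
  rintro _ ⟨f, hf, -, a, ha, rfl⟩
  exact mem_RsetOn_of_mem_support (hJ hf) ha.1

theorem IncCompatible.le_iff {c : ℕ} {T : TermOrder (Fin c × ℕ)} (hT : IncCompatible c T)
    {p : ℕ → ℕ} (hp : StrictMono p) (a b : (Fin c × ℕ) →₀ ℕ) :
    T.le (a.mapDomain (incVar c p)) (b.mapDomain (incVar c p)) ↔ T.le a b := by
  refine ⟨fun h => (T.total a b).elim id fun hba => ?_, hT p hp a b⟩
  rw [Finsupp.mapDomain_injective (incVar_injective c hp.injective)
    (T.antisymm _ _ h (hT p hp b a hba))]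
  exact T.refl b

theorem isLeadMon_incAct_iff {K : Type*} [Field K] {c : ℕ} {T : TermOrder (Fin c × ℕ)}
    (hT : IncCompatible c T) {p : ℕ → ℕ} (hp : StrictMono p) (f : PolyR K c)
    (b : (Fin c × ℕ) →₀ ℕ) :
    IsLeadMon T (incAct K c p f) b ↔ ∃ a, IsLeadMon T f a ∧ a.mapDomain (incVar c p) = b := by
  classical
  have hsupp : (incAct K c p f).support =
      f.support.image (Finsupp.mapDomain (incVar c p)) :=
    support_rename_of_injective (incVar_injective c hp.injective)
  rw [IsLeadMon, hsupp, Finset.forall_mem_image, Finset.mem_image]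
  constructor
  · rintro ⟨⟨a, ha, rfl⟩, h⟩
    exact ⟨a, ⟨ha, fun b hb => (hT.le_iff hp b a).mp (h hb)⟩, rfl⟩
  · rintro ⟨a, ⟨ha, h⟩, rfl⟩
    exact ⟨⟨a, ha, rfl⟩, fun b hb => (hT.le_iff hp b a).mpr (h b hb)⟩

theorem IsLeadMon.ne_zero {K : Type*} [Field K] {c : ℕ} {T : TermOrder (Fin c × ℕ)}
    {f : PolyR K c} {a : (Fin c × ℕ) →₀ ℕ} (h : IsLeadMon T f a) : f ≠ 0 :=
  support_nonempty.mp ⟨a, h.1⟩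

theorem incAct_image_leadMonSet {K : Type*} [Field K] {c : ℕ} {T : TermOrder (Fin c × ℕ)}
    (hT : IncCompatible c T) {p : ℕ → ℕ} (hp : StrictMono p) (J : Set (PolyR K c)) :
    incAct K c p '' leadMonSet K c T J = leadMonSet K c T (incAct K c p '' J) := by
  apply Set.Subset.antisymm
  · rintro _ ⟨_, ⟨f, hf, -, a, ha, rfl⟩, rfl⟩
    have h := (isLeadMon_incAct_iff hT hp f _).mpr ⟨a, ha, rfl⟩
    exact ⟨_, Set.mem_image_of_mem _ hf, h.ne_zero, _, h, rename_monomial _ _ _⟩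
  · rintro _ ⟨_, ⟨f, hf, rfl⟩, -, b, hb, rfl⟩
    obtain ⟨a, ha, rfl⟩ := (isLeadMon_incAct_iff hT hp f b).mp hb
    exact ⟨_, ⟨f, hf, ha.ne_zero, a, ha, rfl⟩, rename_monomial _ _ _⟩

/-- **Lemma (Statement 9).** Let `n ∈ ℕ`, `J ⊆ R_n` an ideal, and `⪯` an `Inc(ℕ)`-compatible
term order on `R`. Then for every `p ∈ Inc(ℕ)`, `p·in_⪯(J) = in_⪯(p·J)`, where `p·J` is
regarded as an ideal of `R_{p([n])}`. -/
theorem incAct_initial_comm (K : Type*) [Field K] (c : ℕ) (hc : 0 < c)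
    (n : ℕ) (J : Set (PolyR K c)) (hJ : IsIdealOf J (Rset K c n))
    (T : TermOrder (Fin c × ℕ)) (hT : IncCompatible c T)
    (p : ℕ → ℕ) (hp : StrictMono p) :
    (incAct K c p) '' (initialOn K c T {j | j < n} J) =
      initialOn K c T (p '' {j | j < n}) ((incAct K c p) '' J) := by
  rw [initialOn, initialOn, image_spanIn (isIdealOf_RsetOn K c _) (leadMonSet_subset T hJ.1),
    incAct_image_RsetOn, incAct_image_leadMonSet hT hp]
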